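/- arXiv:0712.0807 — 6 statements merged into one kernel-verified Lean document; each statement's English description precedes it below -/
import Mathlib

section
/- Let U ⊆ ℝ² be open and let A, Â : U → O(4,2) be smooth maps; write θ = A⁻¹dA and θ̂ = Â⁻¹dÂ (matrix-valued 1-forms with components θ^I_J, rows and columns indexed 0,…,5), and let A₀, Â₀ : U → ℝ⁶ denote the 0-th columns of A and Â. Assume A and Â are first order frame fields: θ³₀ = θ⁴₀ = 0 and θ̂³₀ = θ̂⁴₀ = 0 on U, and the 1-forms θ¹₀, θ²₀ (respectively θ̂¹₀, θ̂²₀) are pointwise linearly independent on U. Then the following are equivalent: (i) θ̂¹₀ = θ¹₀ and θ̂²₀ = θ²₀ on U; (ii) for every p₀ ∈ U there exist ρ₀ ∈ ℝ and a linear form ρ₁ on ℝ² such that, setting D = Â(p₀)·A(p₀)⁻¹ and A′₀ = D·A₀ : U → ℝ⁶, one has Â₀(p₀) = ρ₀·A′₀(p₀) and dÂ₀|_{p₀}(v) = ρ₁(v)·A′₀(p₀) + ρ₀·dA′₀|_{p₀}(v) for all v ∈ ℝ². (Condition (ii) says that f̂ = [Â₀] and the displaced surface D·f, f = [A₀], have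 first order analytic contact at every point, i.e. f and f̂ are first order conformal deformations of each other with infinitesimal displacement ÂA⁻¹.) -/
open Matrix

noncomputable section

attribute [local instance] Matrix.normedAddCommGroup Matrix.normedSpace

/-- The matrix type of frames. -/
abbrev Mat6 := Matrix (Fin 6) (Fin 6) ℝ

/-- Gram matrix of the bilinear form
`⟨x,y⟩ = −(x⁰y⁵ + x⁵y⁰) + x¹y¹ + x²y² + x³y³ − x⁴y⁴` on `ℝ⁶`. -/
def Gm : Mat6 :=
  !![0,0,0,0,0,-1; 0,1,0,0,0,0; 0,0,1,0,0,0; 0,0,0,1,0,0; 0,0,0,0,-1,0; -1,0,0,0,0,0]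

/-- Membership in `O(4,2)`. -/
def O42 (A : Mat6) : Prop := Aᵀ * Gm * A = Gm

/-- The pulled-back Maurer–Cartan form `θ = A⁻¹dA`, evaluated at `p` on the
tangent vector `v`. -/
def mcForm (A : ℝ × ℝ → Mat6) (p v : ℝ × ℝ) : Mat6 := (A p)⁻¹ * fderiv ℝ A p v

/-- The `0`-th column, after left multiplication by `M`, as a linear map. -/
def mulCol (M : Mat6) : Mat6 →ₗ[ℝ] (Fin 6 → ℝ) where
  toFun B := fun i => (M * B) i 0
  map_add' B C := by ext i; simp [Matrix.mul_add]
  map_smul' c B := by ext i; simp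

lemma hasFDerivAt_mulCol {A : ℝ × ℝ → Mat6} {p : ℝ × ℝ} (h : DifferentiableAt ℝ A p) (M : Mat6) :
    HasFDerivAt (fun q => (fun i => (M * A q) i 0))
      ((LinearMap.toContinuousLinearMap (mulCol M)).comp (fderiv ℝ A p)) p :=
  (LinearMap.toContinuousLinearMap (mulCol M)).hasFDerivAt.comp p h.hasFDerivAt

lemma fderiv_mulCol_apply {A : ℝ × ℝ → Mat6} {p : ℝ × ℝ} (h : DifferentiableAt ℝ A p) (M : Mat6)
    (v : ℝ × ℝ) :
    fderiv ℝ (fun q => (fun i => (M * A q) i 0)) p v = fun i => (M * fderiv ℝ A p v) i 0 := by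
  rw [(hasFDerivAt_mulCol h M).fderiv]
  rfl

lemma fderiv_col_apply {A : ℝ × ℝ → Mat6} {p : ℝ × ℝ} (h : DifferentiableAt ℝ A p)
    (v : ℝ × ℝ) :
    fderiv ℝ (fun q => (fun i => A q i 0)) p v = fun i => fderiv ℝ A p v i 0 := by
  simpa using fderiv_mulCol_apply h 1 v

lemma O42.isUnit_det {A : Mat6} (h : O42 A) : IsUnit A.det := by
  have hG : Gm * Gm = 1 := by
    ext i j
    fin_cases i <;> fin_cases j <;> simp [Gm, Matrix.mul_apply, Fin.sum_univ_succ]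
  have hinv : (Gm * Aᵀ * Gm) * A = 1 := by
    rw [Matrix.mul_assoc Gm, Matrix.mul_assoc Gm, h, hG]
  exact Matrix.isUnit_det_of_left_inverse hinv

lemma mul_mcForm {A : ℝ × ℝ → Mat6} {p : ℝ × ℝ} (h : O42 (A p)) (v : ℝ × ℝ) :
    A p * mcForm A p v = fderiv ℝ A p v := by
  rw [mcForm, Matrix.mul_nonsing_inv_cancel_left _ _ h.isUnit_det]

/-- The position vector of a frame is null, hence orthogonal to its derivative. -/
lemma mcForm_five_zero {U : Set (ℝ × ℝ)} (hU : IsOpen U) {A : ℝ × ℝ → Mat6}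
    (hAO : ∀ p ∈ U, O42 (A p)) {p : ℝ × ℝ} (hp : p ∈ U) (h : DifferentiableAt ℝ A p)
    (v : ℝ × ℝ) : mcForm A p v 5 0 = 0 := by
  have hnull : ∀ q ∈ U, -2 * (A q 0 0 * A q 5 0) + A q 1 0 * A q 1 0 + A q 2 0 * A q 2 0 +
      A q 3 0 * A q 3 0 - A q 4 0 * A q 4 0 = 0 := by
    intro q hq
    have h00 := congrFun (congrFun (hAO q hq) 0) 0
    simp [Gm, Matrix.mul_apply, Fin.sum_univ_succ] at h00
    linarith
  have hentry : ∀ i : Fin 6,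
      HasFDerivAt (fun q => A q i 0) (fderiv ℝ (fun q => A q i 0) p) p ∧
        fderiv ℝ (fun q => A q i 0) p v = fderiv ℝ A p v i 0 := by
    intro i
    have hi := hasFDerivAt_pi'.mp (hasFDerivAt_mulCol h 1) i
    simp only [Matrix.one_mul] at hi
    refine ⟨hi.differentiableAt.hasFDerivAt, ?_⟩
    rw [hi.fderiv]
    simp [mulCol]
  have hm := fun i => (hentry i).1.mul (hentry i).1
  have hd := ((((((hentry 0).1.mul (hentry 5).1).const_mul (-2)).add (hm 1)).add (hm 2)).add
    (hm 3)).sub (hm 4)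
  have hz := hd.unique ((hasFDerivAt_const (0 : ℝ) p).congr_of_eventuallyEq
    (Filter.eventually_of_mem (hU.mem_nhds hp) hnull))
  have hzv := congrArg (fun L => L v) hz
  simp [(hentry _).2] at hzv
  have hG : (A p)ᵀ * Gm * fderiv ℝ A p v = Gm * mcForm A p v := by
    rw [← mul_mcForm (hAO p hp) v, ← Matrix.mul_assoc, hAO p hp]
  have h00 := congrFun (congrFun hG 0) 0
  simp [Gm, Matrix.mul_apply, Fin.sum_univ_succ] at h00
  linarith

/-- The component `θ⁰₀` as a linear form. -/
def mcFormZero (A : ℝ × ℝ → Mat6) (p : ℝ × ℝ) : ℝ × ℝ →ₗ[ℝ] ℝ where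
  toFun v := mcForm A p v 0 0
  map_add' v w := by simp [mcForm, Matrix.mul_add]
  map_smul' c v := by simp [mcForm]

/-- Infinitesimal contact at `p`, read in the frame `Ah p`. -/
lemma contact_iff {A Ah : ℝ × ℝ → Mat6} {p : ℝ × ℝ} (hA : DifferentiableAt ℝ A p)
    (hAh : DifferentiableAt ℝ Ah p) (hO : O42 (A p)) (hOh : O42 (Ah p)) (r s : ℝ) (v : ℝ × ℝ) :
    fderiv ℝ (fun q => (fun i => Ah q i 0)) p v =
        r • (fun i => ((Ah p * (A p)⁻¹) * A p) i 0) +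
        s • fderiv ℝ (fun q => (fun i => ((Ah p * (A p)⁻¹) * A q) i 0)) p v ↔
      ∀ i, mcForm Ah p v i 0 = r * (1 : Mat6) i 0 + s * mcForm A p v i 0 := by
  rw [fderiv_col_apply hAh, fderiv_mulCol_apply hA,
    Matrix.nonsing_inv_mul_cancel_right _ _ hO.isUnit_det, Matrix.mul_assoc, ← mul_mcForm hOh]
  change (fun i => (Ah p * mcForm Ah p v) i 0) =
    r • (fun i => Ah p i 0) + s • (fun i => (Ah p * mcForm A p v) i 0) ↔ _
  have hcol : ∀ B : Mat6, (fun i => (Ah p * B) i 0) = Ah p *ᵥ (fun i => B i 0) := fun B => rfl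
  have hone : (fun i => Ah p i 0) = Ah p *ᵥ (fun i => (1 : Mat6) i 0) := by
    rw [← hcol, Matrix.mul_one]
  rw [hcol, hcol, hone, ← Matrix.mulVec_smul, ← Matrix.mulVec_smul, ← Matrix.mulVec_add,
    (Matrix.mulVec_injective_iff_isUnit.mpr
      ((Matrix.isUnit_iff_isUnit_det _).mpr hOh.isUnit_det)).eq_iff, funext_iff]
  rfl

/-- for smooth first order frame fields `A, Â : U → O(4,2)`, the equality of
the Maurer–Cartan components `θ̂¹₀ = θ¹₀`, `θ̂²₀ = θ²₀` is equivalent to first order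
analytic contact, at every point `p₀ ∈ U`, of `f̂ = [Â₀]` with the displaced surface
`D·f`, `D = Â(p₀)A(p₀)⁻¹`, i.e. to `f` and `f̂` being first order conformal
deformations of each other with infinitesimal displacement `ÂA⁻¹`. -/
theorem first_order_deformation_iff
    (U : Set (ℝ × ℝ)) (hU : IsOpen U)
    (A Ah : ℝ × ℝ → Mat6)
    (hA : ContDiffOn ℝ (⊤ : ℕ∞) A U) (hAh : ContDiffOn ℝ (⊤ : ℕ∞) Ah U)
    (hAO : ∀ p ∈ U, O42 (A p)) (hAhO : ∀ p ∈ U, O42 (Ah p))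
    -- first order frame fields: θ³₀ = θ⁴₀ = 0
    (hA1 : ∀ p ∈ U, ∀ v : ℝ × ℝ, mcForm A p v 3 0 = 0 ∧ mcForm A p v 4 0 = 0)
    (hAh1 : ∀ p ∈ U, ∀ v : ℝ × ℝ, mcForm Ah p v 3 0 = 0 ∧ mcForm Ah p v 4 0 = 0)
    -- pointwise linear independence of θ¹₀, θ²₀ and of θ̂¹₀, θ̂²₀
    (hAind : ∀ p ∈ U, ∀ c : ℝ × ℝ,
      (∀ v : ℝ × ℝ, c.1 * mcForm A p v 1 0 + c.2 * mcForm A p v 2 0 = 0) → c = 0)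
    (hAhind : ∀ p ∈ U, ∀ c : ℝ × ℝ,
      (∀ v : ℝ × ℝ, c.1 * mcForm Ah p v 1 0 + c.2 * mcForm Ah p v 2 0 = 0) → c = 0) :
    -- (i)  θ̂¹₀ = θ¹₀ and θ̂²₀ = θ²₀ on U
    (∀ p ∈ U, ∀ v : ℝ × ℝ,
        mcForm Ah p v 1 0 = mcForm A p v 1 0 ∧ mcForm Ah p v 2 0 = mcForm A p v 2 0)
      ↔
    -- (ii) first order analytic contact at every point with the displaced surface
    (∀ p₀ ∈ U, ∃ (ρ₀ : ℝ) (ρ₁ : ℝ × ℝ →ₗ[ℝ] ℝ),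
      (fun i => Ah p₀ i 0) =
          ρ₀ • (fun i => ((Ah p₀ * (A p₀)⁻¹) * A p₀) i 0) ∧
      ∀ v : ℝ × ℝ,
        fderiv ℝ (fun p => (fun i => Ah p i 0)) p₀ v =
          ρ₁ v • (fun i => ((Ah p₀ * (A p₀)⁻¹) * A p₀) i 0) +
          ρ₀ • fderiv ℝ (fun p => (fun i => ((Ah p₀ * (A p₀)⁻¹) * A p) i 0)) p₀ v) := by
  have hdA : ∀ p ∈ U, DifferentiableAt ℝ A p := fun p hp =>
    (hA.contDiffAt (hU.mem_nhds hp)).differentiableAt (by simp)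
  have hdAh : ∀ p ∈ U, DifferentiableAt ℝ Ah p := fun p hp =>
    (hAh.contDiffAt (hU.mem_nhds hp)).differentiableAt (by simp)
  constructor
  · intro h p hp
    refine ⟨1, mcFormZero Ah p - mcFormZero A p, ?_, fun v => ?_⟩
    · rw [Matrix.nonsing_inv_mul_cancel_right _ _ (hAO p hp).isUnit_det, one_smul]
    · rw [contact_iff (hdA p hp) (hdAh p hp) (hAO p hp) (hAhO p hp)]
      intro i
      fin_cases i
      · change mcForm Ah p v 0 0 = (mcForm Ah p v 0 0 - mcForm A p v 0 0) * (1 : Mat6) 0 0 +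
          1 * mcForm A p v 0 0
        simp
      · simpa using (h p hp v).1
      · simpa using (h p hp v).2
      · simp [(hA1 p hp v).1, (hAh1 p hp v).1]
      · simp [(hA1 p hp v).2, (hAh1 p hp v).2]
      · simp [mcForm_five_zero hU hAO hp (hdA p hp), mcForm_five_zero hU hAhO hp (hdAh p hp)]
  · intro h p hp v
    obtain ⟨s, r, h0, h1⟩ := h p hp
    rw [Matrix.nonsing_inv_mul_cancel_right _ _ (hAO p hp).isUnit_det] at h0
    have hs : s = 1 := by
      by_contra hne
      have hcol : ∀ i, Ah p i 0 = 0 := fun i => by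
        have hi := congrFun h0 i
        simp only [Pi.smul_apply, smul_eq_mul] at hi
        exact (mul_eq_zero.mp (show (s - 1) * Ah p i 0 = 0 by linarith)).resolve_left
          (sub_ne_zero.mpr hne)
      exact (hAhO p hp).isUnit_det.ne_zero (Matrix.det_eq_zero_of_column_eq_zero 0 hcol)
    have hv := (contact_iff (hdA p hp) (hdAh p hp) (hAO p hp) (hAhO p hp) _ _ _).mp (h1 v)
    subst hs
    exact ⟨by simpa using hv 1, by simpa using hv 2⟩
end
end

section
/- Let U ⊆ ℝ² be open, p₀ ∈ U, and k ≥ 0 an integer. Let h, ĥ : U → ℝ⁴ be smooth maps, and set ξ = X₀∘h and ζ = X₀∘ĥ : U → ℝ⁶, where X₀(y) = (1, y¹, y², y³, y⁴, ½((y¹)²+(y²)²+(y³)²−(y⁴)²)). Let F = F⁰·ξ and F̂ = F̂⁰·ζ, where F⁰, F̂⁰ : U → ℝ∖{0} are smooth scalar functions (so F and F̂ are arbitrary smooth lifts of the projective maps [ξ] and [ζ] into ℝP⁵). Then the following are equivalent: (i) for every r = 0,…,k, the r-th iterated Fréchet derivatives of ξ and ζ at p₀ coincide (analytic contact of order k at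 p₀); (ii) there exist symmetric r-linear forms ρ_r : (ℝ²)ʳ → ℝ, r = 0,…,k, such that for every r = 0,…,k and every v ∈ ℝ²: DʳF̂(p₀)(v,…,v) = Σ_{h=0}^{r} C(r,h)·ρ_{r−h}(v,…,v)·DʰF(p₀)(v,…,v), where Dʳ denotes the r-th iterated Fréchet derivative and C(r,h) is the binomial coefficient. -/
noncomputable section

/-- The chart `X₀(y) = (1, y, ½(y,y))` of the Lie quadric centered at `[e₀]`, where
`(y,y) = (y¹)² + (y²)² + (y³)² − (y⁴)²`. -/
def X₀ (y : Fin 4 → ℝ) : Fin 6 → ℝ :=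
  ![1, y 0, y 1, y 2, y 3, (1/2) * ((y 0)^2 + (y 1)^2 + (y 2)^2 - (y 3)^2)]

/-- The `n`-th derivative of a `C^n` function is symmetric. -/
theorem iteratedFDeriv_comp_perm_of_contDiffAt
    {E F : Type*} [NormedAddCommGroup E] [NormedSpace ℝ E] [NormedAddCommGroup F] [NormedSpace ℝ F]
    {f : E → F} {n : ℕ} {x : E} (hf : ContDiffAt ℝ n f x) (σ : Equiv.Perm (Fin n))
    (m : Fin n → E) :
    iteratedFDeriv ℝ n f x (m ∘ σ) = iteratedFDeriv ℝ n f x m := by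
  induction n generalizing x with
  | zero => exact congrArg _ (Subsingleton.elim _ _)
  | succ n ih =>
    have hσ : σ ∈ Submonoid.closure
        (Set.range fun i : Fin n ↦ Equiv.swap i.castSucc i.succ) := by
      rw [Equiv.Perm.mclosure_swap_castSucc_succ]; trivial
    induction hσ using Submonoid.closure_induction generalizing m with
    | one => rfl
    | mul σ τ _ _ hσ hτ => rw [Equiv.Perm.coe_mul, ← Function.comp_assoc, hτ, hσ]
    | mem σ hσ =>
      obtain ⟨i, rfl⟩ := hσ
      have hev : ∀ᶠ y in nhds x, ContDiffAt ℝ (n + 1 : ℕ) f y := hf.eventually (by simp)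
      have hd : DifferentiableAt ℝ (iteratedFDeriv ℝ n f) x :=
        hf.differentiableAt_iteratedFDeriv (by exact_mod_cast n.lt_succ_self)
      rw [hd.iteratedFDeriv_succ_apply_left', hd.iteratedFDeriv_succ_apply_left']
      rcases n with _ | n
      · exact i.elim0
      refine Fin.cases ?_ (fun j ↦ ?_) i
      · have hG : ContDiffAt ℝ 2 (iteratedFDeriv ℝ n f) x :=
          hf.iteratedFDeriv_right (by norm_cast; omega)
        have hdG : DifferentiableAt ℝ (fderiv ℝ (iteratedFDeriv ℝ n f)) x :=
          (hG.fderiv_right (m := 1) (by norm_num)).differentiableAt (by simp)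
        have key (a b : E) (w : Fin n → E) :
            fderiv ℝ (fun y ↦ fderiv ℝ (iteratedFDeriv ℝ n f) y b w) x a =
              fderiv ℝ (fderiv ℝ (iteratedFDeriv ℝ n f)) x a b w := by
          have h1 := (hdG.hasFDerivAt.clm_apply (hasFDerivAt_const b x))
          have h2 :=
            (ContinuousMultilinearMap.apply ℝ (fun _ : Fin n ↦ E) F w).hasFDerivAt.comp x h1
          have := congrArg (· a) h2.fderiv
          simpa [Function.comp_def] using this
        have hsymm : IsSymmSndFDerivAt ℝ (iteratedFDeriv ℝ n f) x :=
          hG.isSymmSndFDerivAt (by simp)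
        simp only [iteratedFDeriv_succ_apply_left, key]
        rw [hsymm.eq]
        congr 1
      · have h0 : (m ∘ Equiv.swap j.succ.castSucc j.succ.succ) 0 = m 0 := by
          rw [Function.comp_apply, Equiv.swap_apply_of_ne_of_ne]
          · simp [Fin.ext_iff]
          · simp [Fin.ext_iff]
        have ht : Fin.tail (m ∘ Equiv.swap j.succ.castSucc j.succ.succ) =
            Fin.tail m ∘ Equiv.swap j.castSucc j.succ := by
          funext l
          simp only [Fin.tail, Function.comp_apply]
          rw [← Fin.succ_castSucc, (Fin.succ_injective _).swap_apply]
        rw [h0, ht]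
        congr 1
        refine Filter.EventuallyEq.fderiv_eq ?_
        filter_upwards [hev] with y hy
        exact ih (hy.of_le (by norm_cast; omega)) _ _

/-- Symmetric iterated derivatives are determined by their diagonal values. -/
theorem iteratedFDeriv_eq_of_diag_eq
    {E F : Type*} [NormedAddCommGroup E] [NormedSpace ℝ E] [NormedAddCommGroup F] [NormedSpace ℝ F]
    {f g : E → F} {n : ℕ} {x : E} (hf : ContDiffAt ℝ n f x) (hg : ContDiffAt ℝ n g x)
    (h : ∀ v, iteratedFDeriv ℝ n f x (fun _ ↦ v) = iteratedFDeriv ℝ n g x (fun _ ↦ v)) :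
    iteratedFDeriv ℝ n f x = iteratedFDeriv ℝ n g x := by
  ext1 v
  have h1 := (iteratedFDeriv ℝ n f x).iteratedFDeriv_comp_diagonal 0 v
  have h2 := (iteratedFDeriv ℝ n g x).iteratedFDeriv_comp_diagonal 0 v
  have hs (σ : Equiv.Perm (Fin n)) := iteratedFDeriv_comp_perm_of_contDiffAt hf σ v
  have hs' (σ : Equiv.Perm (Fin n)) := iteratedFDeriv_comp_perm_of_contDiffAt hg σ v
  simp only [Function.comp_def] at hs hs'
  simp only [h, hs, hs', Finset.sum_const] at h1 h2
  rw [h1, ← Nat.cast_smul_eq_nsmul ℝ, ← Nat.cast_smul_eq_nsmul ℝ] at h2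
  exact smul_right_injective F
    (Nat.cast_ne_zero.2 (by simp [Nat.factorial_ne_zero, Fintype.card_perm])) h2

theorem iteratedDeriv_comp_add_smul
    {E F : Type*} [NormedAddCommGroup E] [NormedSpace ℝ E] [NormedAddCommGroup F] [NormedSpace ℝ F]
    {f : E → F} {n : ℕ} {x v : E} {t : ℝ} (hf : ContDiffAt ℝ n f (x + t • v)) :
    iteratedDeriv n (fun s : ℝ ↦ f (x + s • v)) t =
      iteratedFDeriv ℝ n f (x + t • v) (fun _ ↦ v) := by
  induction n generalizing t with
  | zero => simp
  | succ n ih =>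
    have hc : ContinuousAt (fun s : ℝ ↦ x + s • v) t := by fun_prop
    have heq : iteratedDeriv n (fun s : ℝ ↦ f (x + s • v)) =ᶠ[nhds t]
        fun s ↦ iteratedFDeriv ℝ n f (x + s • v) (fun _ ↦ v) := by
      filter_upwards [hc.eventually (hf.eventually (by simp))] with s hs
      exact ih (hs.of_le (by norm_cast; omega))
    rw [iteratedDeriv_succ, heq.deriv_eq]
    exact ContDiffAt.deriv_fderiv_add_smul (by exact_mod_cast hf)

theorem iteratedFDeriv_diag_eq_iteratedDeriv
    {E F : Type*} [NormedAddCommGroup E] [NormedSpace ℝ E] [NormedAddCommGroup F] [NormedSpace ℝ F]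
    {f : E → F} {n : ℕ} {x : E} (hf : ContDiffAt ℝ n f x) (v : E) :
    iteratedFDeriv ℝ n f x (fun _ ↦ v) = iteratedDeriv n (fun s : ℝ ↦ f (x + s • v)) 0 := by
  have hx : x + (0 : ℝ) • v = x := by simp
  rw [iteratedDeriv_comp_add_smul (by rwa [hx]), hx]

theorem ContDiffAt.comp_add_smul_zero
    {E F : Type*} [NormedAddCommGroup E] [NormedSpace ℝ E] [NormedAddCommGroup F] [NormedSpace ℝ F]
    {f : E → F} {n : ℕ} {x : E} (hf : ContDiffAt ℝ n f x) (v : E) :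
    ContDiffAt ℝ n (fun s : ℝ ↦ f (x + s • v)) 0 :=
  ContDiffAt.comp (0 : ℝ) (g := f) (by simpa using hf) (by fun_prop)

/-- Leibniz rule for the iterated derivative of a product along a single direction. -/
theorem iteratedFDeriv_smul_diag
    {E F : Type*} [NormedAddCommGroup E] [NormedSpace ℝ E] [NormedAddCommGroup F] [NormedSpace ℝ F]
    {c : E → ℝ} {g : E → F} {n : ℕ} {x : E} (hc : ContDiffAt ℝ n c x) (hg : ContDiffAt ℝ n g x)
    (v : E) :
    iteratedFDeriv ℝ n (fun p ↦ c p • g p) x (fun _ ↦ v) =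
      ∑ i ∈ Finset.range (n + 1), n.choose i • iteratedFDeriv ℝ i c x (fun _ ↦ v) •
        iteratedFDeriv ℝ (n - i) g x (fun _ ↦ v) := by
  rw [iteratedFDeriv_diag_eq_iteratedDeriv (hc.fun_smul hg)]
  have := iteratedDerivWithin_smul (Set.mem_univ 0) uniqueDiffOn_univ
    (hc.comp_add_smul_zero v).contDiffWithinAt (hg.comp_add_smul_zero v).contDiffWithinAt
  simp only [iteratedDerivWithin_univ] at this
  refine this.trans (Finset.sum_congr rfl fun i hi ↦ ?_)
  have hi : i ≤ n := Nat.lt_succ_iff.1 (Finset.mem_range.1 hi)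
  rw [iteratedFDeriv_diag_eq_iteratedDeriv (hc.of_le (by exact_mod_cast hi)),
    iteratedFDeriv_diag_eq_iteratedDeriv (hg.of_le (by exact_mod_cast n.sub_le i))]

theorem eq_of_binomial_sum_eq {V : Type*} [AddCommGroup V] [Module ℝ V] {c : ℕ → ℝ} {s t : ℕ → V}
    {k : ℕ} (hc : c 0 ≠ 0)
    (h : ∀ r ≤ k, ∑ i ∈ Finset.range (r + 1), r.choose i • c i • s (r - i) =
      ∑ i ∈ Finset.range (r + 1), r.choose i • c i • t (r - i)) :
    ∀ r ≤ k, s r = t r := by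
  intro r
  induction r using Nat.strong_induction_on with
  | _ r ih =>
    intro hr
    have hsum := h r hr
    rw [Finset.sum_range_succ', Finset.sum_range_succ'] at hsum
    rw [Finset.sum_congr rfl fun i hi ↦ by
      rw [ih (r - (i + 1)) (by have := Finset.mem_range.1 hi; omega) (by omega)]] at hsum
    simpa [hc] using hsum

theorem sum_range_choose_smul_reflect {V : Type*} [AddCommGroup V] [Module ℝ V] (c : ℕ → ℝ)
    (s : ℕ → V) (r : ℕ) :
    ∑ i ∈ Finset.range (r + 1), r.choose i • c i • s (r - i) =
      ∑ j ∈ Finset.range (r + 1), ((r.choose j : ℝ) * c (r - j)) • s j := by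
  rw [← Finset.sum_range_reflect]
  refine Finset.sum_congr rfl fun j hj ↦ ?_
  have hj : j ≤ r := Nat.lt_succ_iff.1 (Finset.mem_range.1 hj)
  rw [Nat.add_sub_cancel, Nat.choose_symm hj, Nat.sub_sub_self hj, mul_smul, Nat.cast_smul_eq_nsmul]

theorem contDiff_X₀ {n : WithTop ℕ∞} : ContDiff ℝ n X₀ := by
  refine contDiff_pi.2 fun i ↦ ?_
  fin_cases i <;> simp [X₀] <;> fun_prop

/-- Let `ξ = X₀∘h`, `ζ = X₀∘ĥ` be chart representatives of two maps into
the Lie quadric and `F = F⁰·ξ`, `F̂ = F̂⁰·ζ` arbitrary smooth lifts (with nonvanishing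
smooth scalars `F⁰, F̂⁰`). Then `ξ` and `ζ` have the same iterated Fréchet derivatives
at `p₀` up to order `k` (analytic contact of order `k` at `p₀`) if and only if there
are symmetric `r`-linear forms `ρ_r`, `r = 0,…,k`, with
`DʳF̂(p₀)(v,…,v) = Σ_{h=0}^{r} C(r,h)·ρ_{r−h}(v,…,v)·DʰF(p₀)(v,…,v)` for all `v`. -/
theorem contact_order_k_iff
    (U : Set (ℝ × ℝ)) (hU : IsOpen U) (p₀ : ℝ × ℝ) (hp₀ : p₀ ∈ U) (k : ℕ)
    (h hh : ℝ × ℝ → (Fin 4 → ℝ))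
    (hsm : ContDiffOn ℝ (⊤ : ℕ∞) h U) (hhsm : ContDiffOn ℝ (⊤ : ℕ∞) hh U)
    (F0 Fh0 : ℝ × ℝ → ℝ)
    (hF0 : ContDiffOn ℝ (⊤ : ℕ∞) F0 U) (hFh0 : ContDiffOn ℝ (⊤ : ℕ∞) Fh0 U)
    (hF0ne : ∀ p ∈ U, F0 p ≠ 0) (hFh0ne : ∀ p ∈ U, Fh0 p ≠ 0) :
    -- (i) same iterated Fréchet derivatives of ξ = X₀∘h and ζ = X₀∘ĥ at p₀ up to order k
    (∀ r ≤ k,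
        iteratedFDeriv ℝ r (fun p => X₀ (h p)) p₀ =
          iteratedFDeriv ℝ r (fun p => X₀ (hh p)) p₀)
      ↔
    -- (ii) contact conditions for the lifts F = F⁰·ξ and F̂ = F̂⁰·ζ
    (∃ ρ : (r : ℕ) → MultilinearMap ℝ (fun _ : Fin r => ℝ × ℝ) ℝ,
      (∀ r : ℕ, ∀ σ : Equiv.Perm (Fin r), ∀ m : Fin r → ℝ × ℝ,
          ρ r (fun i => m (σ i)) = ρ r m) ∧
      (∀ r ≤ k, ∀ v : ℝ × ℝ,
        iteratedFDeriv ℝ r (fun p => Fh0 p • X₀ (hh p)) p₀ (fun _ => v) =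
          ∑ j ∈ Finset.range (r + 1),
            ((r.choose j : ℝ) * ρ (r - j) (fun _ => v)) •
              iteratedFDeriv ℝ j (fun p => F0 p • X₀ (h p)) p₀ (fun _ => v))) := by
  have smooth {F : Type} [NormedAddCommGroup F] [NormedSpace ℝ F] {f : ℝ × ℝ → F}
      (hf : ContDiffOn ℝ (⊤ : ℕ∞) f U) (n : ℕ) : ContDiffAt ℝ n f p₀ :=
    (hf.contDiffAt (hU.mem_nhds hp₀)).of_le (by exact_mod_cast le_top)
  have hξ : ContDiffOn ℝ (⊤ : ℕ∞) (fun p ↦ X₀ (h p)) U := contDiff_X₀.comp_contDiffOn hsm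
  have hζ : ContDiffOn ℝ (⊤ : ℕ∞) (fun p ↦ X₀ (hh p)) U := contDiff_X₀.comp_contDiffOn hhsm
  have hq : ContDiffOn ℝ (⊤ : ℕ∞) (fun p ↦ Fh0 p / F0 p) U := hFh0.div hF0 hF0ne
  have hquot (r : ℕ) (v : ℝ × ℝ) : iteratedFDeriv ℝ r (fun p ↦ Fh0 p • X₀ (h p)) p₀ (fun _ ↦ v) =
      ∑ j ∈ Finset.range (r + 1),
        ((r.choose j : ℝ) * iteratedFDeriv ℝ (r - j) (fun p ↦ Fh0 p / F0 p) p₀ (fun _ ↦ v)) •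
          iteratedFDeriv ℝ j (fun p ↦ F0 p • X₀ (h p)) p₀ (fun _ ↦ v) := by
    refine Eq.trans ?_ ((iteratedFDeriv_smul_diag (smooth hq r)
      (smooth (hF0.smul hξ) r) v).trans (sum_range_choose_smul_reflect
        (fun i ↦ iteratedFDeriv ℝ i (fun p ↦ Fh0 p / F0 p) p₀ (fun _ ↦ v))
        (fun i ↦ iteratedFDeriv ℝ i (fun p ↦ F0 p • X₀ (h p)) p₀ (fun _ ↦ v)) r))
    have heq : (fun p ↦ Fh0 p • X₀ (h p)) =ᶠ[nhds p₀]
        fun p ↦ (Fh0 p / F0 p) • (F0 p • X₀ (h p)) := by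
      filter_upwards [hU.mem_nhds hp₀] with p hp
      rw [smul_smul, div_mul_cancel₀ _ (hF0ne p hp)]
    exact congrArg (· fun _ ↦ v) (heq.iteratedFDeriv ℝ r).eq_of_nhds
  constructor
  · intro hcontact
    refine ⟨fun r ↦ (iteratedFDeriv ℝ r (fun p ↦ Fh0 p / F0 p) p₀).toMultilinearMap,
      fun r σ m ↦ iteratedFDeriv_comp_perm_of_contDiffAt (smooth hq r) σ m, fun r hr v ↦ ?_⟩
    refine Eq.trans ?_ (hquot r v)
    rw [iteratedFDeriv_smul_diag (smooth hFh0 r) (smooth hζ r),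
      iteratedFDeriv_smul_diag (smooth hFh0 r) (smooth hξ r)]
    refine Finset.sum_congr rfl fun i _ ↦ ?_
    rw [hcontact (r - i) ((r.sub_le i).trans hr)]
  · rintro ⟨ρ, -, hρ⟩
    have hzero {c : ℝ × ℝ → ℝ} {g : ℝ × ℝ → Fin 4 → ℝ} (hc : ContDiffOn ℝ (⊤ : ℕ∞) c U)
        (hg : ContDiffOn ℝ (⊤ : ℕ∞) g U) (r : ℕ) (v : ℝ × ℝ) :
        iteratedFDeriv ℝ r (fun p ↦ c p • X₀ (g p)) p₀ (fun _ ↦ v) 0 =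
          iteratedFDeriv ℝ r c p₀ (fun _ ↦ v) := by
      have hcomp : (ContinuousLinearMap.proj (R := ℝ) (φ := fun _ : Fin 6 ↦ ℝ) 0) ∘
          (fun p ↦ c p • X₀ (g p)) = c := by
        funext p
        simp [X₀]
      have hproj := ContinuousLinearMap.iteratedFDeriv_comp_left
        (ContinuousLinearMap.proj (R := ℝ) (φ := fun _ : Fin 6 ↦ ℝ) 0)
        (smooth (hc.smul (contDiff_X₀.comp_contDiffOn hg)) r) le_rfl
      exact (congrArg (· fun _ ↦ v) hproj.symm).trans
        (congrArg (fun f ↦ iteratedFDeriv ℝ r f p₀ (fun _ ↦ v)) hcomp)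
    refine fun r hr ↦ iteratedFDeriv_eq_of_diag_eq (smooth hξ r) (smooth hζ r) fun v ↦ ?_
    have hρq : ∀ r ≤ k, ρ r (fun _ ↦ v) =
        iteratedFDeriv ℝ r (fun p ↦ Fh0 p / F0 p) p₀ (fun _ ↦ v) := by
      refine eq_of_binomial_sum_eq (c := fun j ↦ iteratedFDeriv ℝ j F0 p₀ (fun _ ↦ v))
        (s := fun j ↦ ρ j (fun _ ↦ v))
        (t := fun j ↦ iteratedFDeriv ℝ j (fun p ↦ Fh0 p / F0 p) p₀ (fun _ ↦ v))
        (by simpa using hF0ne p₀ hp₀) fun r hr ↦ ?_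
      have h1 := congrFun (hρ r hr v) 0
      have h2 := congrFun (hquot r v) 0
      simp only [Finset.sum_apply, Pi.smul_apply, hzero hFh0 hhsm, hzero hFh0 hsm,
        hzero hF0 hsm] at h1 h2
      have h3 := h1.symm.trans h2
      simpa only [nsmul_eq_mul, smul_eq_mul, mul_assoc, mul_comm, mul_left_comm] using h3
    refine eq_of_binomial_sum_eq (c := fun j ↦ iteratedFDeriv ℝ j Fh0 p₀ (fun _ ↦ v))
      (s := fun j ↦ iteratedFDeriv ℝ j (fun p ↦ X₀ (h p)) p₀ (fun _ ↦ v))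
      (t := fun j ↦ iteratedFDeriv ℝ j (fun p ↦ X₀ (hh p)) p₀ (fun _ ↦ v))
      (by simpa using hFh0ne p₀ hp₀) (fun r hr ↦ ?_) r hr
    refine (iteratedFDeriv_smul_diag (smooth hFh0 r) (smooth hξ r) v).symm.trans
      (Eq.trans ?_ (iteratedFDeriv_smul_diag (smooth hFh0 r) (smooth hζ r) v))
    rw [hquot, hρ r hr]
    refine Finset.sum_congr rfl fun j _ ↦ ?_
    rw [hρq _ ((r.sub_le j).trans hr)]
end
end

section
/- Let U ⊆ ℝ² be open, p₀ ∈ U, h, ĥ : U → ℝ⁴ smooth, ξ = X₀∘h, ζ = X₀∘ĥ with X₀(y) = (1, y, ½((y¹)²+(y²)²+(y³)²−(y⁴)²)), and let F = F⁰·ξ, F̂ = F̂⁰·ζ with smooth F⁰, F̂⁰ : U → ℝ∖{0}. Then ξ and ζ have the same value, first derivative and second iterated Fréchet derivative at p₀ (second order analytic contact at p₀) if and only if there exist ρ₀ ∈ ℝ, a linear form ρ₁ on ℝ², and a symmetric bilinear form ρ₂ on ℝ² such that for all v ∈ ℝ²: F̂(p₀) = ρ₀F(p₀), dF̂|_{p₀}(v)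 = ρ₁(v)F(p₀) + ρ₀dF|_{p₀}(v), and D²F̂(p₀)(v,v) = ρ₂(v,v)F(p₀) + 2ρ₁(v)dF|_{p₀}(v) + ρ₀D²F(p₀)(v,v), where D² denotes the second iterated Fréchet derivative. -/
noncomputable section

section SecondOrderContact

variable {E V : Type*} [NormedAddCommGroup E] [NormedSpace ℝ E]
  [NormedAddCommGroup V] [NormedSpace ℝ V]

/-- The second order Leibniz rule on the diagonal. -/
theorem iteratedFDeriv_two_smul_diag {a : E → ℝ} {f : E → V} {p : E}
    (ha : ContDiffAt ℝ 2 a p) (hf : ContDiffAt ℝ 2 f p) (v : E) :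
    iteratedFDeriv ℝ 2 (fun q => a q • f q) p ![v, v] =
      iteratedFDeriv ℝ 2 a p ![v, v] • f p + (2 * fderiv ℝ a p v) • fderiv ℝ f p v +
        a p • iteratedFDeriv ℝ 2 f p ![v, v] := by
  have hfd : fderiv ℝ (fun q => a q • f q) =ᶠ[nhds p]
      fun q => a q • fderiv ℝ f q + (fderiv ℝ a q).smulRight (f q) := by
    filter_upwards [ha.eventually (by simp), hf.eventually (by simp)] with q hqa hqf
    exact fderiv_fun_smul (hqa.differentiableAt (by simp)) (hqf.differentiableAt (by simp))
  have ha1 := ha.differentiableAt (by simp)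
  have hf1 := hf.differentiableAt (by simp)
  have ha2 : DifferentiableAt ℝ (fderiv ℝ a) p :=
    (ha.fderiv_right (m := 1) (by norm_num)).differentiableAt (by simp)
  have hf2 : DifferentiableAt ℝ (fderiv ℝ f) p :=
    (hf.fderiv_right (m := 1) (by norm_num)).differentiableAt (by simp)
  have key := (ha1.hasFDerivAt.smul hf2.hasFDerivAt).add
    (((ContinuousLinearMap.smulRightL ℝ E V).isBoundedBilinearMap.hasFDerivAt
      (fderiv ℝ a p, f p)).comp p (ha2.hasFDerivAt.prodMk hf1.hasFDerivAt))
  have h2 := (key.congr_of_eventuallyEq hfd).fderiv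
  simp only [iteratedFDeriv_two_apply, Matrix.cons_val_zero, Matrix.cons_val_one, h2]
  simp
  module

/-- Polarization: the second derivative is determined by its values on the diagonal. -/
theorem iteratedFDeriv_two_eq_of_diag {f g : E → V} {p : E}
    (hf : ContDiffAt ℝ 2 f p) (hg : ContDiffAt ℝ 2 g p)
    (h : ∀ v, iteratedFDeriv ℝ 2 f p ![v, v] = iteratedFDeriv ℝ 2 g p ![v, v]) :
    iteratedFDeriv ℝ 2 f p = iteratedFDeriv ℝ 2 g p := by
  have hfs := hf.isSymmSndFDerivAt (by simp)
  have hgs := hg.isSymmSndFDerivAt (by simp)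
  simp only [iteratedFDeriv_two_apply, Matrix.cons_val_zero, Matrix.cons_val_one] at h
  ext m
  rw [iteratedFDeriv_two_apply, iteratedFDeriv_two_apply]
  have hadd := h (m 0 + m 1)
  simp only [map_add, add_apply, h (m 0), h (m 1), hfs (m 1) (m 0),
    hgs (m 1) (m 0)] at hadd
  have h2 : (2 : ℝ) • fderiv ℝ (fderiv ℝ f) p (m 0) (m 1) =
      (2 : ℝ) • fderiv ℝ (fderiv ℝ g) p (m 0) (m 1) := by
    linear_combination (norm := module) hadd
  exact smul_right_injective V two_ne_zero h2

theorem ContinuousLinearMap.fderiv_apply_eq_zero_of_comp_const (l : V →L[ℝ] ℝ) {f : E → V}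
    {p : E} {c : ℝ} (hf : DifferentiableAt ℝ f p) (hl : ∀ q, l (f q) = c) (v : E) :
    l (fderiv ℝ f p v) = 0 := by
  have h := (l.hasFDerivAt.comp p hf.hasFDerivAt).fderiv
  have hc : (l ∘ f) = fun _ => c := funext hl
  rw [hc, fderiv_fun_const] at h
  simpa using (congrArg (fun L => L v) h).symm

theorem ContinuousLinearMap.iteratedFDeriv_two_apply_eq_zero_of_comp_const (l : V →L[ℝ] ℝ)
    {f : E → V} {p : E} {c : ℝ} (hf : ContDiffAt ℝ 2 f p) (hl : ∀ q, l (f q) = c)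
    (m : Fin 2 → E) : l (iteratedFDeriv ℝ 2 f p m) = 0 := by
  have h := l.iteratedFDeriv_comp_left hf (i := 2) le_rfl
  have hc : (l ∘ f) = fun _ => c := funext hl
  rw [hc, iteratedFDeriv_const_of_ne (by norm_num)] at h
  simpa using (congrArg (fun L => L m) h).symm

/-- Two maps normalized by `l = 1` have the same 2-jet at `p` if and only if the 2-jets of
their multiples `a • f` and `b • g` are related by a 2-jet of a scaling function. -/
theorem second_order_contact_iff_of_normalized (l : V →L[ℝ] ℝ) {f g : E → V} {a b : E → ℝ} {p : E}
    (hf : ContDiffAt ℝ 2 f p) (hg : ContDiffAt ℝ 2 g p)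
    (ha : ContDiffAt ℝ 2 a p) (hb : ContDiffAt ℝ 2 b p) (ha0 : a p ≠ 0) (hb0 : b p ≠ 0)
    (hlf : ∀ q, l (f q) = 1) (hlg : ∀ q, l (g q) = 1) :
    (f p = g p ∧ fderiv ℝ f p = fderiv ℝ g p ∧ iteratedFDeriv ℝ 2 f p = iteratedFDeriv ℝ 2 g p)
      ↔
    (∃ (ρ₀ : ℝ) (ρ₁ : E →ₗ[ℝ] ℝ) (ρ₂ : E →ₗ[ℝ] E →ₗ[ℝ] ℝ),
      (∀ v w : E, ρ₂ v w = ρ₂ w v) ∧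
      b p • g p = ρ₀ • (a p • f p) ∧
      (∀ v : E,
        fderiv ℝ (fun p => b p • g p) p v =
          ρ₁ v • (a p • f p) + ρ₀ • fderiv ℝ (fun p => a p • f p) p v) ∧
      (∀ v : E,
        iteratedFDeriv ℝ 2 (fun p => b p • g p) p ![v, v] =
          ρ₂ v v • (a p • f p) +
            (2 * ρ₁ v) • fderiv ℝ (fun p => a p • f p) p v +
            ρ₀ • iteratedFDeriv ℝ 2 (fun p => a p • f p) p ![v, v])) := by
  have dF : ∀ v, fderiv ℝ (fun p => a p • f p) p v =
      a p • fderiv ℝ f p v + fderiv ℝ a p v • f p := fun v => by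
    rw [fderiv_fun_smul (ha.differentiableAt (by simp)) (hf.differentiableAt (by simp))]
    simp
  have dG : ∀ v, fderiv ℝ (fun p => b p • g p) p v =
      b p • fderiv ℝ g p v + fderiv ℝ b p v • g p := fun v => by
    rw [fderiv_fun_smul (hb.differentiableAt (by simp)) (hg.differentiableAt (by simp))]
    simp
  simp only [dF, dG, iteratedFDeriv_two_smul_diag ha hf, iteratedFDeriv_two_smul_diag hb hg]
  constructor
  · rintro ⟨h0, h1, h2⟩
    let ρ₁ : E →L[ℝ] ℝ := (a p)⁻¹ • (fderiv ℝ b p - (b p / a p) • fderiv ℝ a p)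
    let B : E →L[ℝ] E →L[ℝ] ℝ := (a p)⁻¹ • (fderiv ℝ (fderiv ℝ b) p
      - (ρ₁.smulRight (fderiv ℝ a p) + (fderiv ℝ a p).smulRight ρ₁)
      - (b p / a p) • fderiv ℝ (fderiv ℝ a) p)
    have hB : ∀ v w, B v w = (a p)⁻¹ * (fderiv ℝ (fderiv ℝ b) p v w
        - (ρ₁ v * fderiv ℝ a p w + fderiv ℝ a p v * ρ₁ w)
        - (b p / a p) * fderiv ℝ (fderiv ℝ a) p v w) := fun v w => by
      simp [B]
    have hρ₁ : ∀ v, fderiv ℝ b p v = ρ₁ v * a p + b p / a p * fderiv ℝ a p v := fun v => by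
      simp only [ρ₁, smul_apply, sub_apply, smul_eq_mul]
      field_simp
      ring
    refine ⟨b p / a p, ρ₁, ContinuousLinearMap.toBilinForm B, fun v w => ?_, ?_, fun v => ?_,
      fun v => ?_⟩
    · change B v w = B w v
      rw [hB, hB, (ha.isSymmSndFDerivAt (by simp)) v w,
        (hb.isSymmSndFDerivAt (by simp)) v w]
      ring
    · rw [h0, smul_smul, div_mul_cancel₀ _ ha0]
    · rw [← h0, ← h1]
      match_scalars
      · field_simp
      · simp [hρ₁]
    · change _ = B v v • _ + (2 * ρ₁ v) • _ + _
      rw [← h0, ← h1, ← h2, hB, hρ₁]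
      simp only [iteratedFDeriv_two_apply, Matrix.cons_val_zero, Matrix.cons_val_one]
      match_scalars
      · field_simp
        ring
      · field_simp
      · field_simp
  · rintro ⟨ρ₀, ρ₁, ρ₂, -, h0, h1, h2⟩
    have lf1 := l.fderiv_apply_eq_zero_of_comp_const (hf.differentiableAt (by simp)) hlf
    have lg1 := l.fderiv_apply_eq_zero_of_comp_const (hg.differentiableAt (by simp)) hlg
    have lf2 := l.iteratedFDeriv_two_apply_eq_zero_of_comp_const hf hlf
    have lg2 := l.iteratedFDeriv_two_apply_eq_zero_of_comp_const hg hlg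
    have e0 : b p = ρ₀ * a p := by simpa [hlf, hlg] using congrArg l h0
    have e1 : ∀ v, fderiv ℝ b p v = ρ₁ v * a p + ρ₀ * fderiv ℝ a p v := fun v => by
      simpa [hlf, hlg, lf1, lg1] using congrArg l (h1 v)
    have e2 : ∀ v, iteratedFDeriv ℝ 2 b p ![v, v] = ρ₂ v v * a p + 2 * ρ₁ v * fderiv ℝ a p v +
        ρ₀ * iteratedFDeriv ℝ 2 a p ![v, v] := fun v => by
      simpa [hlf, hlg, lf1, lg1, lf2, lg2] using congrArg l (h2 v)
    have hfg : f p = g p := by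
      rw [smul_smul, ← e0] at h0
      exact (smul_right_injective V hb0 h0).symm
    have hfg1 : ∀ v, fderiv ℝ f p v = fderiv ℝ g p v := fun v => by
      refine smul_right_injective V hb0 ?_
      have := h1 v
      rw [e1, ← hfg] at this
      linear_combination (norm := module) e0 • fderiv ℝ f p v - this
    refine ⟨hfg, ContinuousLinearMap.ext hfg1, iteratedFDeriv_two_eq_of_diag hf hg fun v => ?_⟩
    refine smul_right_injective V hb0 ?_
    have := h2 v
    rw [e1, e2, ← hfg, ← hfg1] at this
    linear_combination (norm := module) e0 • iteratedFDeriv ℝ 2 f p ![v, v] - this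

end SecondOrderContact

/-- `ξ = X₀∘h` and `ζ = X₀∘ĥ` have second order analytic contact at `p₀`
(same value, first derivative and second iterated Fréchet derivative at `p₀`) if and
only if the lifts `F = F⁰·ξ`, `F̂ = F̂⁰·ζ` satisfy `F̂(p₀) = ρ₀F(p₀)`,
`dF̂|_{p₀}(v) = ρ₁(v)F(p₀) + ρ₀dF|_{p₀}(v)` and
`D²F̂(p₀)(v,v) = ρ₂(v,v)F(p₀) + 2ρ₁(v)dF|_{p₀}(v) + ρ₀D²F(p₀)(v,v)` for some
`ρ₀ ∈ ℝ`, a linear form `ρ₁` and a symmetric bilinear form `ρ₂` on `ℝ²`. -/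
theorem second_order_contact_iff
    (U : Set (ℝ × ℝ)) (hU : IsOpen U) (p₀ : ℝ × ℝ) (hp₀ : p₀ ∈ U)
    (h hh : ℝ × ℝ → (Fin 4 → ℝ))
    (hsm : ContDiffOn ℝ (⊤ : ℕ∞) h U) (hhsm : ContDiffOn ℝ (⊤ : ℕ∞) hh U)
    (F0 Fh0 : ℝ × ℝ → ℝ)
    (hF0 : ContDiffOn ℝ (⊤ : ℕ∞) F0 U) (hFh0 : ContDiffOn ℝ (⊤ : ℕ∞) Fh0 U)
    (hF0ne : ∀ p ∈ U, F0 p ≠ 0) (hFh0ne : ∀ p ∈ U, Fh0 p ≠ 0) :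
    (X₀ (h p₀) = X₀ (hh p₀) ∧
        fderiv ℝ (fun p => X₀ (h p)) p₀ = fderiv ℝ (fun p => X₀ (hh p)) p₀ ∧
        iteratedFDeriv ℝ 2 (fun p => X₀ (h p)) p₀ =
          iteratedFDeriv ℝ 2 (fun p => X₀ (hh p)) p₀)
      ↔
    (∃ (ρ₀ : ℝ) (ρ₁ : ℝ × ℝ →ₗ[ℝ] ℝ) (ρ₂ : ℝ × ℝ →ₗ[ℝ] ℝ × ℝ →ₗ[ℝ] ℝ),
      (∀ v w : ℝ × ℝ, ρ₂ v w = ρ₂ w v) ∧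
      Fh0 p₀ • X₀ (hh p₀) = ρ₀ • (F0 p₀ • X₀ (h p₀)) ∧
      (∀ v : ℝ × ℝ,
        fderiv ℝ (fun p => Fh0 p • X₀ (hh p)) p₀ v =
          ρ₁ v • (F0 p₀ • X₀ (h p₀)) +
            ρ₀ • fderiv ℝ (fun p => F0 p • X₀ (h p)) p₀ v) ∧
      (∀ v : ℝ × ℝ,
        iteratedFDeriv ℝ 2 (fun p => Fh0 p • X₀ (hh p)) p₀ ![v, v] =
          ρ₂ v v • (F0 p₀ • X₀ (h p₀)) +
            (2 * ρ₁ v) • fderiv ℝ (fun p => F0 p • X₀ (h p)) p₀ v +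
            ρ₀ • iteratedFDeriv ℝ 2 (fun p => F0 p • X₀ (h p)) p₀ ![v, v])) := by
  have hnhds : U ∈ nhds p₀ := hU.mem_nhds hp₀
  have h2 : (2 : WithTop ℕ∞) ≤ ((⊤ : ℕ∞) : WithTop ℕ∞) :=
    WithTop.coe_le_coe.2 (le_top : (2 : ℕ∞) ≤ ⊤)
  exact second_order_contact_iff_of_normalized
    (ContinuousLinearMap.proj (R := ℝ) (φ := fun _ : Fin 6 => ℝ) 0)
    (contDiff_X₀.contDiffAt.comp p₀ ((hsm.contDiffAt hnhds).of_le h2))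
    (contDiff_X₀.contDiffAt.comp p₀ ((hhsm.contDiffAt hnhds).of_le h2))
    ((hF0.contDiffAt hnhds).of_le h2) ((hFh0.contDiffAt hnhds).of_le h2)
    (hF0ne p₀ hp₀) (hFh0ne p₀ hp₀) (fun _ => by simp [X₀]) (fun _ => by simp [X₀])
end
end

section
/- Let a₁, a₂, b₁, …, b₉ be real numbers and consider the eight vectors in ℝ¹¹: v₁ = (−b₅, −b₆, 0, 0, 0, 0, a₁, a₂, 0, 0, 0), v₂ = (−b₁, −b₂, a₁, a₂, 0, 0, 0, 0, 0, 0, 0), v₃ = (−b₃, −b₄, 0, 0, a₁, a₂, 0, 0, 0, 0, 0), v₄ = (−b₆, b₅, 0, 0, 0, 0, −a₂, a₁, 0, 0, 0), v₅ = (−b₇, 0, 0, 0, −b₉, 0, 0, 0, a₁, 0, b₃), v₆ = (0, −b₇, 0, 0, 0, −b₉, 0, 0, a₂, 0, b₄), v₇ = (b₈, 0, −b₉, 0, 0, 0, 0, 0, 0, −a₁, b₁), v₈ = (0, b₈, 0, −b₉, 0, 0, 0, 0, 0, −a₂, b₂). If b₉·((a₁)² − (a₂)²)·(a₁(b₂b₇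 + b₄b₈) − a₂(b₁b₇ + b₃b₈) + b₉(b₂b₃ − b₁b₄)) ≠ 0, then v₁, …, v₈ are linearly independent. -/
/-- the eight polar equations of a 1-dimensional integral element of the
Pfaffian system of second order conformal deformations, written as vectors in `ℝ¹¹`
in the coframe `(α¹, α², α³₁, α³₂, α⁴₁, α⁴₂, α⁰₁−β⁰₁, α⁰₂−β⁰₂, α⁰₃−β⁰₃, α⁰₄−β⁰₄,
α⁴₃−β⁴₃)`, are linearly independent whenever
`b₉((a₁)²−(a₂)²)(a₁(b₂b₇+b₄b₈) − a₂(b₁b₇+b₃b₈) + b₉(b₂b₃−b₁b₄)) ≠ 0`. -/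
theorem polar_equations_linearIndependent
    (a₁ a₂ b₁ b₂ b₃ b₄ b₅ b₆ b₇ b₈ b₉ : ℝ)
    (hne : b₉ * (a₁ ^ 2 - a₂ ^ 2) *
        (a₁ * (b₂ * b₇ + b₄ * b₈) - a₂ * (b₁ * b₇ + b₃ * b₈) +
          b₉ * (b₂ * b₃ - b₁ * b₄)) ≠ 0) :
    LinearIndependent ℝ
      (![![-b₅, -b₆, 0, 0, 0, 0, a₁, a₂, 0, 0, 0],
         ![-b₁, -b₂, a₁, a₂, 0, 0, 0, 0, 0, 0, 0],
         ![-b₃, -b₄, 0, 0, a₁, a₂, 0, 0, 0, 0, 0],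
         ![-b₆, b₅, 0, 0, 0, 0, -a₂, a₁, 0, 0, 0],
         ![-b₇, 0, 0, 0, -b₉, 0, 0, 0, a₁, 0, b₃],
         ![0, -b₇, 0, 0, 0, -b₉, 0, 0, a₂, 0, b₄],
         ![b₈, 0, -b₉, 0, 0, 0, 0, 0, 0, -a₁, b₁],
         ![0, b₈, 0, -b₉, 0, 0, 0, 0, 0, -a₂, b₂]] :
        Fin 8 → (Fin 11 → ℝ)) := by
  have hb : b₉ ≠ 0 := by
    rintro rfl
    simp at hne
  have ha : a₁ ^ 2 + a₂ ^ 2 ≠ 0 := by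
    intro h
    refine hne ?_
    have h₁ : a₁ ^ 2 = 0 := by nlinarith [sq_nonneg a₁, sq_nonneg a₂]
    have h₂ : a₂ ^ 2 = 0 := by nlinarith [sq_nonneg a₁, sq_nonneg a₂]
    simp [h₁, h₂]
  have eq_zero_of_mul {t : ℝ} (h : (a₁ ^ 2 + a₂ ^ 2) * t = 0) : t = 0 :=
    (mul_eq_zero.mp h).resolve_left ha
  -- A system `a₁ s = b₉ t`, `a₂ s = b₉ u`, `a₁ t + a₂ u = 0` has only the trivial solution.
  have trivial_solution {s t u : ℝ} (ht : a₁ * s = b₉ * t) (hu : a₂ * s = b₉ * u)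
      (h : a₁ * t + a₂ * u = 0) : s = 0 ∧ t = 0 ∧ u = 0 := by
    have hs : s = 0 := eq_zero_of_mul (by linear_combination a₁ * ht + a₂ * hu + b₉ * h)
    subst hs
    exact ⟨rfl, by simpa [hb] using ht.symm, by simpa [hb] using hu.symm⟩
  rw [Fintype.linearIndependent_iff]
  intro c hc
  have e₂ := congrFun hc 2
  have e₃ := congrFun hc 3
  have e₄ := congrFun hc 4
  have e₅ := congrFun hc 5
  have e₆ := congrFun hc 6
  have e₇ := congrFun hc 7
  have e₈ := congrFun hc 8
  have e₉ := congrFun hc 9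
  simp [Fin.sum_univ_succ] at e₂ e₃ e₄ e₅ e₆ e₇ e₈ e₉
  have h₀ : c 0 = 0 := eq_zero_of_mul (by linear_combination a₁ * e₆ + a₂ * e₇)
  have h₃ : c 3 = 0 := eq_zero_of_mul (by linear_combination a₁ * e₇ - a₂ * e₆)
  obtain ⟨h₁, h₆, h₇⟩ : c 1 = 0 ∧ c 6 = 0 ∧ c 7 = 0 :=
    trivial_solution (by linear_combination e₂) (by linear_combination e₃)
      (by linear_combination -e₉)
  obtain ⟨h₂, h₄, h₅⟩ : c 2 = 0 ∧ c 4 = 0 ∧ c 5 = 0 :=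
    trivial_solution (by linear_combination e₄) (by linear_combination e₅)
      (by linear_combination e₈)
  intro i
  fin_cases i <;> assumption
end

section
/- Let U ⊆ ℝ² be open with coordinates (x,y), let k₁, k₂, ψ, u : U → ℝ be smooth, and set ‖k‖ = k₁² − k₂². Define 1-forms χ₁ = ½(u − ‖k‖)dx + ψ dy, χ₂ = ψ dx − ½(u + ‖k‖)dy, τ₁ = (k₁)ₓ dx − (k₁)_y dy, τ₂ = −(k₂)ₓ dx + (k₂)_y dy, and let α be the 6×6 matrix of 1-forms on U determined by the components α⁰₀ = 0, α¹₀ = dx, α²₀ = dy, α³₀ = α⁴₀ = 0, α²₁ = 0, α³₁ = k₁dx, α³₂ = −k₁dy, α⁴₁ = k₂dx, α⁴₂ = −k₂dy, α⁴₃ = 0, α⁰₁ = χ₁, α⁰₂ = χ₂, α⁰₃ = τ₁, α⁰₄ = τ₂, with all remaining entries determined by the condition that α takes values in 𝔬(4,2) (explicitly: α⁰₅ = α⁵₀ = 0, α⁵₅ = −α⁰₀, α¹₅ = α⁰₁, α²₅ = α⁰₂, α³₅ = α⁰₃, α⁴₅ = −α⁰₄, α⁵₁ = α¹₀, α⁵₂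 = α²₀, α⁵₃ = α³₀, α⁵₄ = −α⁴₀, α¹₁ = α²₂ = α³₃ = α⁴₄ = 0, α¹₂ = −α²₁, α¹₃ = −α³₁, α²₃ = −α³₂, α¹₄ = α⁴₁, α²₄ = α⁴₂, α³₄ = α⁴₃). Then α satisfies the Maurer–Cartan equation dα + α∧α = 0 on U if and only if the four equations (k₁)ₓ_y = ψk₁, (k₂)ₓ_y = ψk₂, uₓ = −2(ψ_y + ‖k‖ₓ), u_y = 2(ψₓ + ‖k‖_y) hold on U. -/
open Matrix

noncomputable section

attribute [local instance] Matrix.normedAddCommGroup Matrix.normedSpace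

/-- Partial derivative in the `x`-direction. -/
def pdx (f : ℝ × ℝ → ℝ) (p : ℝ × ℝ) : ℝ := fderiv ℝ f p (1, 0)

/-- Partial derivative in the `y`-direction. -/
def pdy (f : ℝ × ℝ → ℝ) (p : ℝ × ℝ) : ℝ := fderiv ℝ f p (0, 1)

/-- The `dx`-coefficient `P` of the adapted isothermic frame form `α = P dx + Q dy`
built from the data `(k₁, k₂, ψ, u)`; here `‖k‖ = k₁² − k₂²`,
`χ₁ = ½(u − ‖k‖)dx + ψ dy`, `χ₂ = ψ dx − ½(u + ‖k‖)dy`,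
`τ₁ = (k₁)ₓdx − (k₁)_ydy`, `τ₂ = −(k₂)ₓdx + (k₂)_ydy`, and all entries not listed in
the statement are determined by membership in `𝔬(4,2)`. -/
def isoP (k₁ k₂ ψ u : ℝ × ℝ → ℝ) (p : ℝ × ℝ) : Mat6 :=
  !![0, (1/2) * (u p - (k₁ p ^ 2 - k₂ p ^ 2)), ψ p, pdx k₁ p, -(pdx k₂ p), 0;
     1, 0, 0, -(k₁ p), k₂ p, (1/2) * (u p - (k₁ p ^ 2 - k₂ p ^ 2));
     0, 0, 0, 0, 0, ψ p;
     0, k₁ p, 0, 0, 0, pdx k₁ p;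
     0, k₂ p, 0, 0, 0, pdx k₂ p;
     0, 1, 0, 0, 0, 0]

/-- The `dy`-coefficient `Q` of the adapted isothermic frame form `α = P dx + Q dy`. -/
def isoQ (k₁ k₂ ψ u : ℝ × ℝ → ℝ) (p : ℝ × ℝ) : Mat6 :=
  !![0, ψ p, -(1/2) * (u p + (k₁ p ^ 2 - k₂ p ^ 2)), -(pdy k₁ p), pdy k₂ p, 0;
     0, 0, 0, 0, 0, ψ p;
     1, 0, 0, k₁ p, -(k₂ p), -(1/2) * (u p + (k₁ p ^ 2 - k₂ p ^ 2));
     0, 0, -(k₁ p), 0, 0, -(pdy k₁ p);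
     0, 0, -(k₂ p), 0, 0, -(pdy k₂ p);
     0, 0, 1, 0, 0, 0]

/-- The derivative of a matrix-valued map is computed entrywise. -/
theorem fderiv_matrix_apply {E m n : Type*} [NormedAddCommGroup E] [NormedSpace ℝ E]
    [Fintype m] [Fintype n] {A : E → Matrix m n ℝ} {p : E}
    (h : ∀ i j, DifferentiableAt ℝ (fun q => A q i j) p) (v : E) (i : m) (j : n) :
    fderiv ℝ A p v i j = fderiv ℝ (fun q => A q i j) p v := by
  have hA : HasFDerivAt (F := m → n → ℝ) A (ContinuousLinearMap.pi fun i =>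
      ContinuousLinearMap.pi fun j => fderiv ℝ (fun q => A q i j) p) p :=
    hasFDerivAt_pi.2 fun i => hasFDerivAt_pi.2 fun j => (h i j).hasFDerivAt
  exact congr_fun₂ (DFunLike.congr_fun (HasFDerivAt.fderiv (F := m → n → ℝ) hA) v) i j

theorem differentiableAt_pdx {f : ℝ × ℝ → ℝ} {p : ℝ × ℝ} (hf : ContDiffAt ℝ 2 f p) :
    DifferentiableAt ℝ (pdx f) p :=
  ((hf.fderiv_right (m := 1) (by norm_num)).differentiableAt one_ne_zero).clm_apply
    (differentiableAt_const _)

theorem differentiableAt_pdy {f : ℝ × ℝ → ℝ} {p : ℝ × ℝ} (hf : ContDiffAt ℝ 2 f p) :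
    DifferentiableAt ℝ (pdy f) p :=
  ((hf.fderiv_right (m := 1) (by norm_num)).differentiableAt one_ne_zero).clm_apply
    (differentiableAt_const _)

/-- Mixed partial derivatives of a `C²` function commute. -/
theorem pdx_pdy_comm {f : ℝ × ℝ → ℝ} {p : ℝ × ℝ} (hf : ContDiffAt ℝ 2 f p) :
    pdx (pdy f) p = pdy (pdx f) p := by
  have hd : DifferentiableAt ℝ (fderiv ℝ f) p :=
    (hf.fderiv_right (m := 1) (by norm_num)).differentiableAt one_ne_zero
  have key (v w : ℝ × ℝ) :
      fderiv ℝ (fun q => fderiv ℝ f q v) p w = fderiv ℝ (fderiv ℝ f) p w v := by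
    rw [fderiv_clm_apply hd (differentiableAt_const v)]
    simp
  have hs := hf.isSymmSndFDerivAt (by simp)
  exact (key _ _).trans ((hs _ _).trans (key _ _).symm)

/-- The derivative of `k₁² − k₂²`. -/
theorem fderiv_sq_sub_sq_apply {f g : ℝ × ℝ → ℝ} {p : ℝ × ℝ} (hf : DifferentiableAt ℝ f p)
    (hg : DifferentiableAt ℝ g p) (v : ℝ × ℝ) :
    fderiv ℝ (fun q => f q ^ 2 - g q ^ 2) p v =
      2 * f p * fderiv ℝ f p v - 2 * g p * fderiv ℝ g p v := by
  rw [fderiv_fun_sub (hf.fun_pow 2) (hg.fun_pow 2), fderiv_fun_pow 2 hf, fderiv_fun_pow 2 hg]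
  simp

section FrameForm

variable {k₁ k₂ ψ u : ℝ × ℝ → ℝ} {p : ℝ × ℝ}

theorem fderiv_isoP_apply (hk₁ : ContDiffAt ℝ 2 k₁ p) (hk₂ : ContDiffAt ℝ 2 k₂ p)
    (hψ : DifferentiableAt ℝ ψ p) (hu : DifferentiableAt ℝ u p) :
    fderiv ℝ (isoP k₁ k₂ ψ u) p (0, 1) =
      let a := (1/2) * (pdy u p - pdy (fun q => k₁ q ^ 2 - k₂ q ^ 2) p)
      !![0, a, pdy ψ p, pdy (pdx k₁) p, -pdy (pdx k₂) p, 0;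
         0, 0, 0, -pdy k₁ p, pdy k₂ p, a;
         0, 0, 0, 0, 0, pdy ψ p;
         0, pdy k₁ p, 0, 0, 0, pdy (pdx k₁) p;
         0, pdy k₂ p, 0, 0, 0, pdy (pdx k₂) p;
         0, 0, 0, 0, 0, 0] := by
  have h₁ := hk₁.differentiableAt two_ne_zero
  have h₂ := hk₂.differentiableAt two_ne_zero
  have h₁x := differentiableAt_pdx hk₁
  have h₂x := differentiableAt_pdx hk₂
  have hN : DifferentiableAt ℝ (fun q => k₁ q ^ 2 - k₂ q ^ 2) p := (h₁.pow 2).sub (h₂.pow 2)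
  have ha : fderiv ℝ (fun q => (1/2 : ℝ) * (u q - (k₁ q ^ 2 - k₂ q ^ 2))) p (0, 1) =
      (1/2) * (pdy u p - pdy (fun q => k₁ q ^ 2 - k₂ q ^ 2) p) := by
    rw [fderiv_const_mul (hu.fun_sub hN), fderiv_fun_sub hu hN]
    rfl
  have hd : DifferentiableAt ℝ (fun q => (1/2 : ℝ) * (u q - (k₁ q ^ 2 - k₂ q ^ 2))) p :=
    (hu.sub hN).const_mul _
  ext i j
  rw [fderiv_matrix_apply]
  · fin_cases i <;> fin_cases j <;>
      first
      | exact ha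
      | simp [isoP, pdy, fderiv_fun_neg]
  · intro i j
    fin_cases i <;> fin_cases j <;>
      first
      | exact differentiableAt_const _
      | assumption
      | exact DifferentiableAt.neg (by assumption)

theorem fderiv_isoQ_apply (hk₁ : ContDiffAt ℝ 2 k₁ p) (hk₂ : ContDiffAt ℝ 2 k₂ p)
    (hψ : DifferentiableAt ℝ ψ p) (hu : DifferentiableAt ℝ u p) :
    fderiv ℝ (isoQ k₁ k₂ ψ u) p (1, 0) =
      let b := -(1/2) * (pdx u p + pdx (fun q => k₁ q ^ 2 - k₂ q ^ 2) p)
      !![0, pdx ψ p, b, -pdx (pdy k₁) p, pdx (pdy k₂) p, 0;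
         0, 0, 0, 0, 0, pdx ψ p;
         0, 0, 0, pdx k₁ p, -pdx k₂ p, b;
         0, 0, -pdx k₁ p, 0, 0, -pdx (pdy k₁) p;
         0, 0, -pdx k₂ p, 0, 0, -pdx (pdy k₂) p;
         0, 0, 0, 0, 0, 0] := by
  have h₁ := hk₁.differentiableAt two_ne_zero
  have h₂ := hk₂.differentiableAt two_ne_zero
  have h₁y := differentiableAt_pdy hk₁
  have h₂y := differentiableAt_pdy hk₂
  have hN : DifferentiableAt ℝ (fun q => k₁ q ^ 2 - k₂ q ^ 2) p := (h₁.pow 2).sub (h₂.pow 2)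
  have hb : fderiv ℝ (fun q => -(1/2 : ℝ) * (u q + (k₁ q ^ 2 - k₂ q ^ 2))) p (1, 0) =
      -(1/2) * (pdx u p + pdx (fun q => k₁ q ^ 2 - k₂ q ^ 2) p) := by
    rw [fderiv_const_mul (hu.fun_add hN), fderiv_fun_add hu hN]
    rfl
  have hd : DifferentiableAt ℝ (fun q => -(1/2 : ℝ) * (u q + (k₁ q ^ 2 - k₂ q ^ 2))) p :=
    (hu.add hN).const_mul _
  ext i j
  rw [fderiv_matrix_apply]
  · fin_cases i <;> fin_cases j <;>
      first
      | exact hb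
      | simp [isoQ, pdx, fderiv_fun_neg]
  · intro i j
    fin_cases i <;> fin_cases j <;>
      first
      | exact differentiableAt_const _
      | assumption
      | exact DifferentiableAt.neg (by assumption)

set_option maxHeartbeats 1000000 in
/-- The Maurer–Cartan curvature of the frame form, entry by entry: its nonzero entries are
multiples of the defects of the four structure equations. -/
theorem isothermic_curvature_eq (hk₁ : ContDiffAt ℝ 2 k₁ p) (hk₂ : ContDiffAt ℝ 2 k₂ p)
    (hψ : DifferentiableAt ℝ ψ p) (hu : DifferentiableAt ℝ u p) :
    fderiv ℝ (isoQ k₁ k₂ ψ u) p (1, 0) - fderiv ℝ (isoP k₁ k₂ ψ u) p (0, 1) +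
        (isoP k₁ k₂ ψ u p * isoQ k₁ k₂ ψ u p - isoQ k₁ k₂ ψ u p * isoP k₁ k₂ ψ u p) =
      let c₁ := pdx ψ p + pdy (fun q => k₁ q ^ 2 - k₂ q ^ 2) p - (1/2) * pdy u p
      let c₂ := -(pdy ψ p + pdx (fun q => k₁ q ^ 2 - k₂ q ^ 2) p + (1/2) * pdx u p)
      let d₁ := 2 * (ψ p * k₁ p - pdy (pdx k₁) p)
      let d₂ := 2 * (ψ p * k₂ p - pdy (pdx k₂) p)
      !![0, c₁, c₂, d₁, -d₂, 0;
         0, 0, 0, 0, 0, c₁;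
         0, 0, 0, 0, 0, c₂;
         0, 0, 0, 0, 0, d₁;
         0, 0, 0, 0, 0, d₂;
         0, 0, 0, 0, 0, 0] := by
  have h₁ := hk₁.differentiableAt two_ne_zero
  have h₂ := hk₂.differentiableAt two_ne_zero
  have hNx : pdx (fun q => k₁ q ^ 2 - k₂ q ^ 2) p =
      2 * k₁ p * pdx k₁ p - 2 * k₂ p * pdx k₂ p := fderiv_sq_sub_sq_apply h₁ h₂ _
  have hNy : pdy (fun q => k₁ q ^ 2 - k₂ q ^ 2) p =
      2 * k₁ p * pdy k₁ p - 2 * k₂ p * pdy k₂ p := fderiv_sq_sub_sq_apply h₁ h₂ _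
  rw [fderiv_isoP_apply hk₁ hk₂ hψ hu, fderiv_isoQ_apply hk₁ hk₂ hψ hu, pdx_pdy_comm hk₁,
    pdx_pdy_comm hk₂, hNx, hNy]
  ext i j
  fin_cases i <;> fin_cases j <;>
    simp [isoP, isoQ] <;> ring

end FrameForm

/-- the adapted isothermic frame form `α = P dx + Q dy` built from
`(k₁, k₂, ψ, u)` satisfies the Maurer–Cartan equation `dα + α∧α = 0`
(i.e. `∂ₓQ − ∂_yP + PQ − QP = 0`) on `U` if and only if the four structure equations
`(k₁)ₓ_y = ψk₁`, `(k₂)ₓ_y = ψk₂`, `uₓ = −2(ψ_y + ‖k‖ₓ)`, `u_y = 2(ψₓ + ‖k‖_y)`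
hold on `U`, where `‖k‖ = k₁² − k₂²`. -/
theorem isothermic_maurer_cartan_iff
    (U : Set (ℝ × ℝ)) (hU : IsOpen U) (k₁ k₂ ψ u : ℝ × ℝ → ℝ)
    (hk₁ : ContDiffOn ℝ (⊤ : ℕ∞) k₁ U) (hk₂ : ContDiffOn ℝ (⊤ : ℕ∞) k₂ U)
    (hψ : ContDiffOn ℝ (⊤ : ℕ∞) ψ U) (hu : ContDiffOn ℝ (⊤ : ℕ∞) u U) :
    (∀ p ∈ U,
        fderiv ℝ (isoQ k₁ k₂ ψ u) p (1, 0) - fderiv ℝ (isoP k₁ k₂ ψ u) p (0, 1) +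
          (isoP k₁ k₂ ψ u p * isoQ k₁ k₂ ψ u p -
            isoQ k₁ k₂ ψ u p * isoP k₁ k₂ ψ u p) = 0)
      ↔
    (∀ p ∈ U,
        pdy (pdx k₁) p = ψ p * k₁ p ∧
        pdy (pdx k₂) p = ψ p * k₂ p ∧
        pdx u p = -2 * (pdy ψ p + pdx (fun q => k₁ q ^ 2 - k₂ q ^ 2) p) ∧
        pdy u p = 2 * (pdx ψ p + pdy (fun q => k₁ q ^ 2 - k₂ q ^ 2) p)) := by
  refine forall₂_congr fun p hp => ?_
  have hUp := hU.mem_nhds hp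
  have two_le : (2 : WithTop ℕ∞) ≤ ((⊤ : ℕ∞) : WithTop ℕ∞) := WithTop.coe_le_coe.2 le_top
  have hk₁p := (hk₁.contDiffAt hUp).of_le two_le
  have hk₂p := (hk₂.contDiffAt hUp).of_le two_le
  have hψp := ((hψ.contDiffAt hUp).of_le two_le).differentiableAt two_ne_zero
  have hup := ((hu.contDiffAt hUp).of_le two_le).differentiableAt two_ne_zero
  rw [isothermic_curvature_eq hk₁p hk₂p hψp hup]
  constructor
  · intro h
    have e₁ := congr_fun₂ h 0 1
    have e₂ := congr_fun₂ h 0 2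
    have e₃ := congr_fun₂ h 3 5
    have e₄ := congr_fun₂ h 4 5
    simp only [Matrix.of_apply, Matrix.cons_val, Matrix.zero_apply] at e₁ e₂ e₃ e₄
    refine ⟨?_, ?_, ?_, ?_⟩ <;> linarith
  · rintro ⟨e₁, e₂, e₃, e₄⟩
    rw [e₁, e₂, e₃, e₄]
    ext i j
    fin_cases i <;> fin_cases j <;> simp
end
end

section
/- An element A ∈ O(4,2) satisfies A(W₀) = W₀, where W₀ = span{e₀, e₁, e₂}, if and only if there exist r ∈ ℝ∖{0}, x, y ∈ ℝ², a ∈ O(2) (aᵀa = I₂), and b ∈ O(1,1) (bᵀ𝕀₁,₁b = 𝕀₁,₁, where 𝕀₁,₁ = diag(1,−1)) such that, in block form with respect to the decomposition ℝe₀ ⊕ span{e₁,e₂} ⊕ span{e₃,e₄} ⊕ ℝe₅, A = [[r, xᵀa, yᵀ𝕀₁,₁b, (xᵀx + yᵀ𝕀₁,₁y)/(2r)], [0, a, 0, x/r], [0, 0, b, y/r], [0, 0, 0, 1/r]]. -/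
open Matrix

noncomputable section

/-- `𝕀₁,₁ = diag(1,−1)`. -/
def I11 : Matrix (Fin 2) (Fin 2) ℝ := Matrix.diagonal ![1, -1]

/-- The block matrix
`[[r, xᵀa, yᵀ𝕀₁,₁b, (xᵀx + yᵀ𝕀₁,₁y)/(2r)], [0, a, 0, x/r], [0, 0, b, y/r], [0, 0, 0, 1/r]]`
with respect to the decomposition `ℝe₀ ⊕ span{e₁,e₂} ⊕ span{e₃,e₄} ⊕ ℝe₅`. -/
def isotropyBlockP (r : ℝ) (x y : Fin 2 → ℝ)
    (a b : Matrix (Fin 2) (Fin 2) ℝ) : Mat6 :=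
  !![r, vecMul x a 0, vecMul x a 1, vecMul (I11.mulVec y) b 0,
       vecMul (I11.mulVec y) b 1, (x ⬝ᵥ x + y ⬝ᵥ I11.mulVec y) / (2 * r);
     0, a 0 0, a 0 1, 0, 0, x 0 / r;
     0, a 1 0, a 1 1, 0, 0, x 1 / r;
     0, 0, 0, b 0 0, b 0 1, y 0 / r;
     0, 0, 0, b 1 0, b 1 1, y 1 / r;
     0, 0, 0, 0, 0, 1 / r]

theorem mem_span_single_zero_one_two (v : Fin 6 → ℝ) :
    v ∈ Submodule.span ℝ {(Pi.single 0 1 : Fin 6 → ℝ), Pi.single 1 1, Pi.single 2 1} ↔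
      v 3 = 0 ∧ v 4 = 0 ∧ v 5 = 0 := by
  rw [Submodule.mem_span_triple]
  constructor
  · rintro ⟨a, b, c, rfl⟩
    simp
  · rintro ⟨h3, h4, h5⟩
    refine ⟨v 0, v 1, v 2, ?_⟩
    ext i
    fin_cases i <;> simp [h3, h4, h5]

theorem Gm_mul_self : Gm * Gm = 1 := by
  ext i j
  fin_cases i <;> fin_cases j <;> simp [Gm, Matrix.mul_apply, Fin.sum_univ_six]

theorem O42.mulVecLin_injective {A : Mat6} (hA : O42 A) : Function.Injective A.mulVecLin := by
  have h : (Gm * Aᵀ * Gm) * A = 1 := by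
    rw [Matrix.mul_assoc, Matrix.mul_assoc, ← Matrix.mul_assoc Aᵀ, show Aᵀ * Gm * A = Gm from hA,
      Gm_mul_self]
  intro v w hvw
  simpa [h] using congrArg (Gm * Aᵀ * Gm).mulVec hvw

theorem O42.form_col {A : Mat6} (hA : O42 A) (i j : Fin 6) :
    -(A 0 i * A 5 j + A 5 i * A 0 j) + A 1 i * A 1 j + A 2 i * A 2 j + A 3 i * A 3 j
      - A 4 i * A 4 j = Gm i j := by
  rw [← show Aᵀ * Gm * A = Gm from hA]
  simp [Gm, Matrix.mul_apply, Fin.sum_univ_six]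
  ring

/-- `A` preserves `W₀` exactly when its lower-left `3 × 3` block vanishes. -/
theorem O42.map_span_eq_iff {A : Mat6} (hA : O42 A) :
    (Submodule.span ℝ
        {(Pi.single 0 1 : Fin 6 → ℝ), Pi.single 1 1, Pi.single 2 1}).map A.mulVecLin =
      Submodule.span ℝ {(Pi.single 0 1 : Fin 6 → ℝ), Pi.single 1 1, Pi.single 2 1}
      ↔ ∀ j ∈ ({0, 1, 2} : Set (Fin 6)), A 3 j = 0 ∧ A 4 j = 0 ∧ A 5 j = 0 := by
  have hle : (Submodule.span ℝ
        {(Pi.single 0 1 : Fin 6 → ℝ), Pi.single 1 1, Pi.single 2 1}).map A.mulVecLin ≤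
      Submodule.span ℝ {(Pi.single 0 1 : Fin 6 → ℝ), Pi.single 1 1, Pi.single 2 1}
      ↔ ∀ j ∈ ({0, 1, 2} : Set (Fin 6)), A 3 j = 0 ∧ A 4 j = 0 ∧ A 5 j = 0 := by
    rw [Submodule.map_le_iff_le_comap, Submodule.span_le]
    simp [Set.insert_subset_iff, mem_span_single_zero_one_two]
  rw [← hle]
  refine ⟨le_of_eq, fun h => Submodule.eq_of_le_of_finrank_eq h ?_⟩
  exact (Submodule.equivMapOfInjective _ hA.mulVecLin_injective _).finrank_eq.symm

theorem O42.exists_eq_isotropyBlockP {A : Mat6} (hA : O42 A)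
    (h : ∀ j ∈ ({0, 1, 2} : Set (Fin 6)), A 3 j = 0 ∧ A 4 j = 0 ∧ A 5 j = 0) :
    ∃ (r : ℝ) (_ : r ≠ 0) (x y : Fin 2 → ℝ) (a b : Matrix (Fin 2) (Fin 2) ℝ),
      aᵀ * a = 1 ∧ bᵀ * I11 * b = I11 ∧ A = isotropyBlockP r x y a b := by
  obtain ⟨h30, h40, h50⟩ := h 0 (by simp)
  obtain ⟨h31, h41, h51⟩ := h 1 (by simp)
  obtain ⟨h32, h42, h52⟩ := h 2 (by simp)
  have e00 := hA.form_col 0 0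
  have e03 := hA.form_col 0 3
  have e04 := hA.form_col 0 4
  have e05 := hA.form_col 0 5
  have e11 := hA.form_col 1 1
  have e12 := hA.form_col 1 2
  have e22 := hA.form_col 2 2
  have e13 := hA.form_col 1 3
  have e14 := hA.form_col 1 4
  have e15 := hA.form_col 1 5
  have e23 := hA.form_col 2 3
  have e24 := hA.form_col 2 4
  have e25 := hA.form_col 2 5
  have e33 := hA.form_col 3 3
  have e34 := hA.form_col 3 4
  have e44 := hA.form_col 4 4
  have e35 := hA.form_col 3 5
  have e45 := hA.form_col 4 5
  have e55 := hA.form_col 5 5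
  simp [Gm, h30, h40, h50, h31, h41, h51, h32, h42, h52]
    at e00 e03 e04 e05 e11 e12 e22 e13 e14 e15 e23 e24 e25 e33 e34 e44 e35 e45 e55
  obtain ⟨h10, h20⟩ := mul_self_add_mul_self_eq_zero.mp e00
  simp only [h10, h20, zero_mul, add_zero] at e03 e04 e05
  have hr5 : A 0 0 * A 5 5 = 1 := by linarith
  have hr : A 0 0 ≠ 0 := left_ne_zero_of_mul_eq_one hr5
  have h55 : A 5 5 = 1 / A 0 0 := by field_simp; linarith
  have h53 : A 5 3 = 0 := by simpa [hr] using e03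
  have h54 : A 5 4 = 0 := by simpa [hr] using e04
  simp only [h53, h54, mul_zero, zero_mul, add_zero, zero_add, neg_zero]
    at e13 e14 e23 e24 e33 e34 e44 e35 e45
  have ha : !![A 1 1, A 1 2; A 2 1, A 2 2]ᵀ * !![A 1 1, A 1 2; A 2 1, A 2 2] = 1 := by
    ext i j
    fin_cases i <;> fin_cases j <;> simp [Matrix.mul_apply] <;> linarith
  have hu : IsUnit (!![A 1 1, A 1 2; A 2 1, A 2 2]ᵀ) := IsUnit.of_mul_eq_one _ ha
  have hker : ∀ v : Fin 2 → ℝ, !![A 1 1, A 1 2; A 2 1, A 2 2]ᵀ *ᵥ v = 0 → v = 0 := fun v hv =>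
    Matrix.mulVec_injective_of_isUnit hu (by simpa using hv)
  have h3 : ![A 1 3, A 2 3] = 0 := hker _ (by
    ext i; fin_cases i <;> simp [Matrix.mulVec, dotProduct] <;> linarith)
  have h4 : ![A 1 4, A 2 4] = 0 := hker _ (by
    ext i; fin_cases i <;> simp [Matrix.mulVec, dotProduct] <;> linarith)
  have h13 : A 1 3 = 0 := congrFun h3 0
  have h23 : A 2 3 = 0 := congrFun h3 1
  have h14 : A 1 4 = 0 := congrFun h4 0
  have h24 : A 2 4 = 0 := congrFun h4 1
  simp only [h13, h14, h23, h24, mul_zero, zero_mul, add_zero, zero_add] at e33 e34 e44 e35 e45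
  refine ⟨A 0 0, hr, ![A 0 0 * A 1 5, A 0 0 * A 2 5], ![A 0 0 * A 3 5, A 0 0 * A 4 5],
    !![A 1 1, A 1 2; A 2 1, A 2 2], !![A 3 3, A 3 4; A 4 3, A 4 4], ha, ?_, ?_⟩
  · ext i j
    fin_cases i <;> fin_cases j <;> simp [Matrix.mul_apply, I11] <;> linarith
  · have h01 : A 0 1 = A 0 0 * A 1 5 * A 1 1 + A 0 0 * A 2 5 * A 2 1 := by
      linear_combination (-A 0 1) * hr5 - A 0 0 * e15
    have h02 : A 0 2 = A 0 0 * A 1 5 * A 1 2 + A 0 0 * A 2 5 * A 2 2 := by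
      linear_combination (-A 0 2) * hr5 - A 0 0 * e25
    have h03 : A 0 3 = A 0 0 * A 3 5 * A 3 3 - A 0 0 * A 4 5 * A 4 3 := by
      linear_combination (-A 0 3) * hr5 - A 0 0 * e35
    have h04 : A 0 4 = A 0 0 * A 3 5 * A 3 4 - A 0 0 * A 4 5 * A 4 4 := by
      linear_combination (-A 0 4) * hr5 - A 0 0 * e45
    have half : A 0 5 = A 0 0 * (A 1 5 ^ 2 + A 2 5 ^ 2 + A 3 5 ^ 2 - A 4 5 ^ 2) / 2 := by
      linear_combination (-A 0 5) * hr5 - A 0 0 / 2 * e55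
    have corner : A 0 5 = (A 0 0 * A 1 5 * (A 0 0 * A 1 5) + A 0 0 * A 2 5 * (A 0 0 * A 2 5)
        + (A 0 0 * A 3 5 * (A 0 0 * A 3 5) - A 0 0 * A 4 5 * (A 0 0 * A 4 5))) / (2 * A 0 0) := by
      rw [half]
      field_simp
      ring
    ext i j
    fin_cases i <;> fin_cases j <;>
      simp [isotropyBlockP, I11, Matrix.vecMul, Matrix.mulVec, dotProduct, ← sub_eq_add_neg, hr,
        h10, h20, h30, h40, h50, h31, h41, h51, h32, h42, h52, h13, h14, h23, h24, h53, h54, h55]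
    all_goals first | exact h01 | exact h02 | exact h03 | exact h04 | exact corner

/-- an element `A ∈ O(4,2)` preserves `W₀ = span{e₀, e₁, e₂}` if and only
if it has the block form
`[[r, xᵀa, yᵀ𝕀₁,₁b, (xᵀx + yᵀ𝕀₁,₁y)/(2r)], [0, a, 0, x/r], [0, 0, b, y/r], [0, 0, 0, 1/r]]`
for some `r ≠ 0`, `x, y ∈ ℝ²`, `a ∈ O(2)` and `b ∈ O(1,1)`. -/
theorem isotropy_at_W0
    (A : Mat6) (hA : O42 A) :
    (Submodule.span ℝ
        {(Pi.single 0 1 : Fin 6 → ℝ), Pi.single 1 1, Pi.single 2 1}).map A.mulVecLin =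
      Submodule.span ℝ
        {(Pi.single 0 1 : Fin 6 → ℝ), Pi.single 1 1, Pi.single 2 1}
      ↔
    ∃ (r : ℝ) (_ : r ≠ 0) (x y : Fin 2 → ℝ) (a b : Matrix (Fin 2) (Fin 2) ℝ),
      aᵀ * a = 1 ∧ bᵀ * I11 * b = I11 ∧ A = isotropyBlockP r x y a b := by
  rw [hA.map_span_eq_iff]
  refine ⟨hA.exists_eq_isotropyBlockP, ?_⟩
  rintro ⟨r, -, x, y, a, b, -, -, rfl⟩
  simp [isotropyBlockP]
end
end
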